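/- arXiv:1605.03648 — 4 statements merged into one kernel-verified Lean document; each statement's English description precedes it below -/
import Mathlib

section
/- Let N ≥ 2, and let L ∈ ℝ^{N×N} be symmetric positive semidefinite with L·𝟙_N = 0 and with kernel exactly the span of 𝟙_N (the Laplacian of a connected undirected graph), and let 0 < λ₂ ≤ … ≤ λ_N denote its nonzero eigenvalues (counted with multiplicity), with λ₂ the smallest and λ_N the largest. Suppose there exist ε > 0, a symmetric positive definite X ∈ ℝ^{n×n}, Y ∈ ℝ^{m×n}, and a diagonal positive definite Z ∈ ℝ^{m×m} such that for both λ = λ₂ and λ = λ_N the symmetric block matrix [[sym(AX + λBΔ₂Y) + εX, BZ + (1/2)λYᵀ(Δ₁−Δ₂)], [(BZ + (1/2)λYᵀ(Δ₁−Δ₂))ᵀ, −Z]] is negative semidefinite. Set K := YX⁻¹. Then for every family of continuous functions f_{i,k} : ℝ → ℝ (i = 1,…,N, k = 1,…,m), each satisfying the sector condition (f_{i,k}(z) − δ_{k,1}z)(f_{i,k}(z) − δ_{k,2}z) ≤ 0 for all z ∈ ℝ, and for every differentiable trajectory x = (x₁,…,x_N) : [0,∞) → (ℝⁿ)^N satisfying,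 for all t ≥ 0 and all i, ẋ_i(t) = A x_i(t) + B·(f_{i,k}(z_{i,k}(t)))_{k=1}^m where z(t) = (z_1(t),…,z_N(t)) := (L ⊗ K)x(t), consensus is reached: ‖x_i(t) − x_j(t)‖ → 0 as t → ∞ for all i, j ∈ {1,…,N}. -/
open Matrix Filter
open scoped Kronecker

/-- `sym(M) := M + Mᵀ`. -/
def symMat {d : Type*} [Fintype d] (M : Matrix d d ℝ) : Matrix d d ℝ := M + Mᵀ

/-- A real symmetric matrix `M` is negative semidefinite if `vᵀMv ≤ 0` for all real `v`. -/
def NegSemidef {d : Type*} [Fintype d] (M : Matrix d d ℝ) : Prop :=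
  ∀ v : d → ℝ, v ⬝ᵥ M *ᵥ v ≤ 0

lemma aux_lmi {n m : ℕ} (A : Matrix (Fin n) (Fin n) ℝ) (B : Matrix (Fin n) (Fin m) ℝ)
    (δ1 δ2 : Fin m → ℝ) (ε : ℝ) (X : Matrix (Fin n) (Fin n) ℝ) (hX : X.PosDef)
    (Y : Matrix (Fin m) (Fin n) ℝ) (ζ : Fin m → ℝ) (hζ : ∀ k, 0 < ζ k) (lamv : ℝ)
    (h : NegSemidef (Matrix.fromBlocks
        (symMat (A * X + lamv • (B * Matrix.diagonal δ2 * Y)) + ε • X)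
        (B * Matrix.diagonal ζ + ((1 / 2) * lamv) • (Yᵀ * (Matrix.diagonal δ1 - Matrix.diagonal δ2)))
        (B * Matrix.diagonal ζ + ((1 / 2) * lamv) • (Yᵀ * (Matrix.diagonal δ1 - Matrix.diagonal δ2)))ᵀ
        (-Matrix.diagonal ζ)))
    (η : Fin n → ℝ) (ω : Fin m → ℝ) :
    (2 * ((X⁻¹ *ᵥ η) ⬝ᵥ (A *ᵥ η + B *ᵥ ω)) + ε * ((X⁻¹ *ᵥ η) ⬝ᵥ η) - ∑ k, ω k ^ 2 / ζ k)
      + lamv * (2 * ((X⁻¹ *ᵥ η) ⬝ᵥ (B *ᵥ (fun k => δ2 k * ((Y * X⁻¹) *ᵥ η) k)))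
        + ∑ k, (δ1 k - δ2 k) * ((Y * X⁻¹) *ᵥ η) k * ω k / ζ k) ≤ 0 := by
  have hdet : IsUnit X.det := (Matrix.isUnit_iff_isUnit_det _).1 hX.isUnit
  have h1 := h (Sum.elim (X⁻¹ *ᵥ η) (fun k => ω k / ζ k))
  have hη : X *ᵥ (X⁻¹ *ᵥ η) = η := by
    rw [Matrix.mulVec_mulVec, Matrix.mul_nonsing_inv _ hdet, Matrix.one_mulVec]
  have hY : (Y * X⁻¹) *ᵥ η = Y *ᵥ (X⁻¹ *ᵥ η) := by rw [Matrix.mulVec_mulVec]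
  rw [hY]
  set ξ := X⁻¹ *ᵥ η with hξ
  have hZ : Matrix.diagonal ζ *ᵥ (fun k => ω k / ζ k) = ω := by
    funext k
    rw [Matrix.mulVec_diagonal]
    have := (hζ k).ne'
    field_simp
  have hsw : ∀ (M : Matrix (Fin n) (Fin m) ℝ) (v : Fin m → ℝ), v ⬝ᵥ (Mᵀ *ᵥ ξ) = ξ ⬝ᵥ (M *ᵥ v) := by
    intro M v
    rw [Matrix.mulVec_transpose, dotProduct_comm, Matrix.dotProduct_mulVec]
  have hsw2 : ∀ (M : Matrix (Fin n) (Fin n) ℝ), ξ ⬝ᵥ (Mᵀ *ᵥ ξ) = ξ ⬝ᵥ (M *ᵥ ξ) := by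
    intro M
    rw [Matrix.mulVec_transpose, dotProduct_comm, ← Matrix.dotProduct_mulVec]
  have hd2 : Matrix.diagonal δ2 *ᵥ (Y *ᵥ ξ) = (fun k => δ2 k * (Y *ᵥ ξ) k) := by
    funext k; rw [Matrix.mulVec_diagonal]
  have hlast : (fun k => ω k / ζ k) ⬝ᵥ ω = ∑ k, ω k ^ 2 / ζ k := by
    simp only [dotProduct]
    exact Finset.sum_congr rfl fun k _ => by ring
  have hcross : ξ ⬝ᵥ (Yᵀ *ᵥ ((Matrix.diagonal δ1 - Matrix.diagonal δ2) *ᵥ (fun k => ω k / ζ k)))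
      = ∑ k, (δ1 k - δ2 k) * (Y *ᵥ ξ) k * ω k / ζ k := by
    rw [Matrix.dotProduct_mulVec, Matrix.vecMul_transpose, Matrix.diagonal_sub]
    simp only [dotProduct, Matrix.mulVec_diagonal]
    exact Finset.sum_congr rfl fun k _ => by ring
  rw [Matrix.fromBlocks_mulVec] at h1
  simp only [Sum.elim_comp_inl, Sum.elim_comp_inr, sumElim_dotProduct_sumElim, dotProduct_add, hsw, symMat,
    Matrix.add_mulVec, hsw2, Matrix.smul_mulVec, ← Matrix.mulVec_mulVec, hη, hZ, hcross,
    Matrix.neg_mulVec, dotProduct_neg, hlast, dotProduct_smul, hd2, smul_eq_mul] at h1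
  rw [dotProduct_add]
  linarith

lemma aux_coord {n : ℕ} (X : Matrix (Fin n) (Fin n) ℝ) (hX : X.PosDef) (η : Fin n → ℝ) (p : Fin n) :
    (η p) ^ 2 ≤ X p p * ((X⁻¹ *ᵥ η) ⬝ᵥ η) := by
  have hdet : IsUnit X.det := (Matrix.isUnit_iff_isUnit_det _).1 hX.isUnit
  have hpp : 0 < X p p := hX.diag_pos
  have hsym : Xᵀ = X := by simpa using hX.isHermitian.eq
  have hη : X *ᵥ (X⁻¹ *ᵥ η) = η := by
    rw [Matrix.mulVec_mulVec, Matrix.mul_nonsing_inv _ hdet, Matrix.one_mulVec]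
  set ξ := X⁻¹ *ᵥ η
  have h := hX.posSemidef.dotProduct_mulVec_nonneg (ξ - (η p / X p p) • Pi.single p 1)
  have e1 : ξ ⬝ᵥ (X *ᵥ Pi.single p 1) = η p := by
    rw [Matrix.dotProduct_mulVec, ← Matrix.mulVec_transpose, hsym, hη]; simp
  simp only [star_trivial, Matrix.mulVec_sub, Matrix.mulVec_smul, hη, sub_dotProduct, dotProduct_sub,
    dotProduct_smul, smul_dotProduct, e1, smul_eq_mul] at h
  simp only [single_dotProduct, one_mul, Matrix.mulVec_single_one, Matrix.col_apply] at h
  have : η p / X p p * X p p = η p := by field_simp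
  have h2 : η p ^ 2 / X p p ≤ ξ ⬝ᵥ η := by
    have e : η p ^ 2 / X p p = η p / X p p * η p := by ring
    rw [this] at h
    rw [e]; linarith
  rwa [div_le_iff₀ hpp, mul_comm] at h2

lemma aux_decay (V V' : ℝ → ℝ) (ε : ℝ) (hε : 0 < ε)
    (hV : ∀ t, 0 ≤ t → HasDerivWithinAt V (V' t) (Set.Ici 0) t)
    (hle : ∀ t, 0 ≤ t → V' t ≤ - ε * V t) (h0 : ∀ t, 0 ≤ V t) :
    Tendsto V atTop (nhds 0) := by
  have hd : ∀ t, 0 ≤ t → HasDerivWithinAt (fun s => V s * Real.exp (ε * s))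
      (V' t * Real.exp (ε * t) + V t * (Real.exp (ε * t) * (ε * 1))) (Set.Ici 0) t := by
    intro t ht
    exact (hV t ht).mul ((((hasDerivAt_id t).const_mul ε).exp).hasDerivWithinAt)
  have hanti : AntitoneOn (fun s => V s * Real.exp (ε * s)) (Set.Ici 0) := by
    apply antitoneOn_of_hasDerivWithinAt_nonpos (convex_Ici 0)
      (fun t ht => (hd t ht).continuousWithinAt)
      (fun t ht => (hd t (interior_subset ht)).mono interior_subset)
    intro t ht
    have := hle t (interior_subset ht)
    have := Real.exp_pos (ε * t)
    nlinarith
  have hlim : Tendsto (fun t => V 0 * Real.exp (-(ε * t))) atTop (nhds 0) := by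
    have : Tendsto (fun t : ℝ => Real.exp (-(ε * t))) atTop (nhds 0) :=
      Real.tendsto_exp_neg_atTop_nhds_zero.comp (tendsto_id.const_mul_atTop hε)
    simpa using this.const_mul (V 0)
  refine tendsto_of_tendsto_of_tendsto_of_le_of_le' tendsto_const_nhds hlim
    (Eventually.of_forall h0) ?_
  filter_upwards [eventually_ge_atTop 0] with t ht
  have h := hanti (Set.mem_Ici.2 le_rfl) (Set.mem_Ici.2 ht) ht
  simp only [mul_zero, Real.exp_zero, mul_one] at h
  rw [Real.exp_neg, ← div_eq_mul_inv, le_div_iff₀ (Real.exp_pos _)]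
  exact h

lemma aux_quad {n : ℕ} (P : Matrix (Fin n) (Fin n) ℝ) (hP : Pᵀ = P) (η : ℝ → Fin n → ℝ)
    (η' : Fin n → ℝ) (s : Set ℝ) (t : ℝ)
    (h : ∀ p, HasDerivWithinAt (fun u => η u p) (η' p) s t) :
    HasDerivWithinAt (fun u => (P *ᵥ η u) ⬝ᵥ η u) (2 * ((P *ᵥ η t) ⬝ᵥ η')) s t := by
  have h1 : HasDerivWithinAt (fun u => ∑ p, (∑ q, P p q * η u q) * η u p)
      (∑ p, ((∑ q, P p q * η' q) * η t p + (∑ q, P p q * η t q) * η' p)) s t :=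
    HasDerivWithinAt.fun_sum fun p _ =>
      (HasDerivWithinAt.fun_sum fun q _ => (h q).const_mul (P p q)).mul (h p)
  have e : (∑ p, ((∑ q, P p q * η' q) * η t p + (∑ q, P p q * η t q) * η' p))
      = 2 * ((P *ᵥ η t) ⬝ᵥ η') := by
    rw [Finset.sum_add_distrib, two_mul]
    congr 1
    change (P *ᵥ η') ⬝ᵥ η t = _
    rw [dotProduct_comm, Matrix.dotProduct_mulVec, ← Matrix.mulVec_transpose, hP]
  rw [e] at h1
  exact h1

/-- Theorem 1, undirected case: let `L` be the Laplacian of a connected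
undirected graph (symmetric, positive semidefinite, `L𝟙 = 0`, kernel exactly `span 𝟙`),
with nonzero eigenvalues `0 < λ₂ ≤ … ≤ λ_N` (encoded by an orthogonal diagonalization
`UᵀLU = diag(lam)` with `lam` nondecreasing, `lam 0 = 0`, so `λ₂ = lam 1` and
`λ_N = lam (N−1)`). If the LMI (8) of the paper is feasible for `λ ∈ {λ₂, λ_N}` with
`X ≻ 0` symmetric, `Z = diag(ζ) ≻ 0` diagonal and some `ε > 0`, and `K := YX⁻¹`, then
for every family of continuous sector-bounded nonlinearities `f_{i,k}` and every
differentiable trajectory of the closed-loop Lur'e network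
`ẋᵢ = Axᵢ + B f_i(z_i)`, `z = (L ⊗ K)x`, consensus is reached:
`‖xᵢ(t) − xⱼ(t)‖ → 0` as `t → ∞`. -/
theorem stmt0 (N n m : ℕ) [NeZero N] (hN : 2 ≤ N)
    (A : Matrix (Fin n) (Fin n) ℝ) (B : Matrix (Fin n) (Fin m) ℝ)
    (δ1 δ2 : Fin m → ℝ) (hδ : ∀ k, δ1 k < δ2 k)
    (Δ₁ Δ₂ : Matrix (Fin m) (Fin m) ℝ)
    (hΔ₁ : Δ₁ = Matrix.diagonal δ1) (hΔ₂ : Δ₂ = Matrix.diagonal δ2)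
    -- the Laplacian of a connected undirected graph
    (L : Matrix (Fin N) (Fin N) ℝ)
    (hLsym : L.IsSymm)
    (hLpsd : ∀ v : Fin N → ℝ, 0 ≤ v ⬝ᵥ L *ᵥ v)
    (hLone : L *ᵥ (fun _ => (1 : ℝ)) = 0)
    (hLker : ∀ v : Fin N → ℝ, L *ᵥ v = 0 → ∃ c : ℝ, v = fun _ => c)
    -- its eigenvalues, sorted and counted with multiplicity
    (U : Matrix (Fin N) (Fin N) ℝ) (hU : Uᵀ * U = 1)
    (lam : Fin N → ℝ) (hlam : Monotone lam) (hlam0 : lam 0 = 0)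
    (hdiag : Uᵀ * L * U = Matrix.diagonal lam)
    -- the LMI data
    (ε : ℝ) (hε : 0 < ε)
    (X : Matrix (Fin n) (Fin n) ℝ) (hX : X.PosDef)
    (Y : Matrix (Fin m) (Fin n) ℝ)
    (ζ : Fin m → ℝ) (hζ : ∀ k, 0 < ζ k)
    (Z : Matrix (Fin m) (Fin m) ℝ) (hZ : Z = Matrix.diagonal ζ)
    -- the LMI holds for λ = λ₂ and λ = λ_N
    (hLMI : ∀ lamv : ℝ, (lamv = lam 1 ∨ lamv = lam ⟨N - 1, by omega⟩) →
      NegSemidef (Matrix.fromBlocks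
        (symMat (A * X + lamv • (B * Δ₂ * Y)) + ε • X)
        (B * Z + ((1 / 2) * lamv) • (Yᵀ * (Δ₁ - Δ₂)))
        (B * Z + ((1 / 2) * lamv) • (Yᵀ * (Δ₁ - Δ₂)))ᵀ
        (-Z)))
    -- controller gain
    (K : Matrix (Fin m) (Fin n) ℝ) (hK : K = Y * X⁻¹)
    -- sector-bounded nonlinearities
    (f : Fin N → Fin m → ℝ → ℝ)
    (hfc : ∀ i k, Continuous (f i k))
    (hsec : ∀ (i : Fin N) (k : Fin m) (zv : ℝ),
      (f i k zv - δ1 k * zv) * (f i k zv - δ2 k * zv) ≤ 0)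
    -- closed-loop trajectory on [0, ∞)
    (x : ℝ → (Fin N × Fin n → ℝ))
    (hode : ∀ t : ℝ, 0 ≤ t → ∀ (i : Fin N) (p : Fin n),
      HasDerivWithinAt (fun s => x s (i, p))
        ((A *ᵥ (fun q => x t (i, q))) p
          + (B *ᵥ (fun k => f i k (((L ⊗ₖ K) *ᵥ x t) (i, k)))) p)
        (Set.Ici 0) t) :
    -- consensus
    ∀ i j : Fin N,
      Tendsto (fun t => Real.sqrt (∑ p, (x t (i, p) - x t (j, p)) ^ 2)) atTop (nhds 0) := by
  intro i j
  subst hΔ₁ hΔ₂ hZ hK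
  have hU' : U * Uᵀ = 1 := mul_eq_one_comm.1 hU
  have hUL : Uᵀ * L = Matrix.diagonal lam * Uᵀ := by
    rw [← hdiag, Matrix.mul_assoc, hU', Matrix.mul_one]
  have hULe : ∀ l b, ∑ a, U a l * L a b = lam l * U b l := by
    intro l b
    have := congrFun (congrFun hUL l) b
    rw [Matrix.diagonal_mul, Matrix.mul_apply] at this
    exact this
  have hUU : ∀ a b : Fin N → ℝ, ∑ l, (∑ i, U i l * a i) * (∑ i, U i l * b i) = ∑ i, a i * b i := by
    intro a b
    have : (Uᵀ *ᵥ a) ⬝ᵥ (Uᵀ *ᵥ b) = a ⬝ᵥ b := by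
      rw [Matrix.dotProduct_mulVec, ← Matrix.mulVec_transpose, Matrix.transpose_transpose,
        Matrix.mulVec_mulVec, hU', Matrix.one_mulVec]
    exact this
  have hcol : ∀ a b, U a 0 = U b 0 := by
    have h0 : L *ᵥ (fun a => U a 0) = 0 := by
      have hs : ∀ a b, L a b = L b a := fun a b => hLsym.apply b a
      funext b
      have := hULe 0 b
      rw [hlam0, zero_mul] at this
      simp only [Matrix.mulVec, dotProduct, Pi.zero_apply]
      rw [← this]
      exact Finset.sum_congr rfl fun a _ => by rw [hs b a]; ring
    obtain ⟨c, hc⟩ := hLker _ h0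
    intro a b
    rw [congrFun hc a, congrFun hc b]
  set K := Y * X⁻¹ with hK
  have hPsym : (X⁻¹)ᵀ = X⁻¹ := by simpa using hX.inv.isHermitian.eq
  set η : Fin N → ℝ → Fin n → ℝ := fun l t p => ∑ i, U i l * x t (i, p) with hη
  set z : ℝ → Fin N → Fin m → ℝ := fun t i k => ((L ⊗ₖ K) *ᵥ x t) (i, k) with hz
  set ω : Fin N → ℝ → Fin m → ℝ :=
    fun l t k => ∑ i, U i l * (f i k (z t i k) - δ2 k * z t i k) with hω
  have hzt : ∀ l t k, ∑ i, U i l * z t i k = lam l * (K *ᵥ η l t) k := by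
    intro l t k
    have e : ∀ i, z t i k = ∑ b, L i b * (K *ᵥ fun q => x t (b, q)) k := by
      intro i
      simp only [hz, Matrix.mulVec, dotProduct, Fintype.sum_prod_type, Matrix.kroneckerMap_apply,
        Finset.mul_sum]
      exact Finset.sum_congr rfl fun b _ => Finset.sum_congr rfl fun q _ => by ring
    simp only [e, Finset.mul_sum]
    rw [Finset.sum_comm]
    have e2 : ∀ b, ∑ a, U a l * (L a b * (K *ᵥ fun q => x t (b, q)) k)
        = lam l * (U b l * (K *ᵥ fun q => x t (b, q)) k) := by
      intro b
      rw [← mul_assoc, ← hULe, Finset.sum_mul]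
      exact Finset.sum_congr rfl fun a _ => by ring
    simp only [e2, ← Finset.mul_sum]
    congr 1
    simp only [hη, Matrix.mulVec, dotProduct, Finset.mul_sum]
    rw [Finset.sum_comm]
    exact Finset.sum_congr rfl fun b _ => Finset.sum_congr rfl fun q _ => by ring
  have hηd : ∀ l t, 0 ≤ t → ∀ p, HasDerivWithinAt (fun s => η l s p)
      ((A *ᵥ η l t + B *ᵥ (fun k => ω l t k + lam l * (δ2 k * (K *ᵥ η l t) k))) p)
      (Set.Ici 0) t := by
    intro l t ht p
    have h1 : HasDerivWithinAt (fun s => ∑ i, U i l * x s (i, p)) _ (Set.Ici 0) t :=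
      HasDerivWithinAt.fun_sum fun i _ => (hode t ht i p).const_mul (U i l)
    refine h1.congr_deriv ?_
    have e : ∀ k, ω l t k + lam l * (δ2 k * (K *ᵥ η l t) k) = ∑ i, U i l * f i k (z t i k) := by
      intro k
      have := hzt l t k
      have e3 : lam l * (δ2 k * (K *ᵥ η l t) k) = δ2 k * (lam l * (K *ᵥ η l t) k) := by ring
      rw [e3, ← this, Finset.mul_sum, ← Finset.sum_add_distrib]
      exact Finset.sum_congr rfl fun a _ => by ring
    simp only [e, Pi.add_apply, mul_add, Finset.sum_add_distrib]
    congr 1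
    · simp only [hη, Matrix.mulVec, dotProduct, Finset.mul_sum]
      rw [Finset.sum_comm]
      exact Finset.sum_congr rfl fun b _ => Finset.sum_congr rfl fun q _ => by ring
    · change ∑ i, U i l * (∑ k, B p k * f i k (z t i k)) = ∑ k, B p k * ∑ i, U i l * f i k (z t i k)
      simp only [Finset.mul_sum]
      rw [Finset.sum_comm]
      exact Finset.sum_congr rfl fun b _ => Finset.sum_congr rfl fun q _ => by ring
  have hQ0 : ∀ l t, 0 ≤ (X⁻¹ *ᵥ η l t) ⬝ᵥ η l t := by
    intro l t
    have := hX.inv.posSemidef.dotProduct_mulVec_nonneg (η l t)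
    rw [dotProduct_comm]
    simpa using this
  set S : Fin N → ℝ → ℝ := fun l t =>
    ∑ k, (ω l t k * ω l t k - (δ1 k - δ2 k) * (ω l t k * (lam l * (K *ᵥ η l t) k))) / ζ k with hS
  have hineq : ∀ l, l ≠ 0 → ∀ t,
      2 * ((X⁻¹ *ᵥ η l t) ⬝ᵥ
        (A *ᵥ η l t + B *ᵥ (fun k => ω l t k + lam l * (δ2 k * (K *ᵥ η l t) k))))
      + ε * ((X⁻¹ *ᵥ η l t) ⬝ᵥ η l t) ≤ S l t := by
    intro l hl t
    have ha := aux_lmi A B δ1 δ2 ε X hX Y ζ hζ _ (hLMI _ (Or.inl rfl)) (η l t) (ω l t)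
    have hb := aux_lmi A B δ1 δ2 ε X hX Y ζ hζ _ (hLMI _ (Or.inr rfl)) (η l t) (ω l t)
    have hla : lam 1 ≤ lam l := by
      apply hlam
      rw [Fin.le_def]
      have h1 : ((1 : Fin N) : ℕ) = 1 := by
        rw [Fin.coe_ofNat_eq_mod, Nat.mod_eq_of_lt (by omega)]
      have : (l : ℕ) ≠ 0 := fun h => hl (Fin.ext (by simpa using h))
      omega
    have hlb : lam l ≤ lam ⟨N - 1, by omega⟩ := by
      apply hlam
      rw [Fin.le_def]
      have := l.isLt
      show (l : ℕ) ≤ N - 1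
      omega
    have eB : B *ᵥ (fun k => ω l t k + lam l * (δ2 k * (K *ᵥ η l t) k))
        = B *ᵥ ω l t + lam l • (B *ᵥ (fun k => δ2 k * (K *ᵥ η l t) k)) := by
      rw [← Matrix.mulVec_smul, ← Matrix.mulVec_add]
      rfl
    have eS : S l t = (∑ k, ω l t k ^ 2 / ζ k)
        - lam l * ∑ k, (δ1 k - δ2 k) * (K *ᵥ η l t) k * ω l t k / ζ k := by
      rw [hS, Finset.mul_sum, ← Finset.sum_sub_distrib]
      exact Finset.sum_congr rfl fun k _ => by ring
    rw [eB, eS, ← add_assoc, dotProduct_add _ (_ + _), dotProduct_smul, smul_eq_mul]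
    set c0 := 2 * ((X⁻¹ *ᵥ η l t) ⬝ᵥ (A *ᵥ η l t + B *ᵥ ω l t))
      + ε * ((X⁻¹ *ᵥ η l t) ⬝ᵥ η l t) - ∑ k, ω l t k ^ 2 / ζ k with hc0
    set c1 := 2 * ((X⁻¹ *ᵥ η l t) ⬝ᵥ (B *ᵥ (fun k => δ2 k * (K *ᵥ η l t) k)))
        + ∑ k, (δ1 k - δ2 k) * (K *ᵥ η l t) k * ω l t k / ζ k with hc1
    have hc : c0 + lam l * c1 ≤ 0 := by
      rcases le_total 0 c1 with h | h
      · exact le_trans (by gcongr) hb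
      · exact le_trans (by nlinarith) ha
    rw [hc0, hc1] at hc
    linarith
  have hSsum : ∀ t, ∑ l ∈ Finset.univ.erase 0, S l t ≤ 0 := by
    intro t
    have hS0 : 0 ≤ S 0 t := by
      refine Finset.sum_nonneg fun k _ => div_nonneg ?_ (hζ k).le
      rw [hlam0]
      nlinarith [mul_self_nonneg (ω 0 t k)]
    have htot : ∑ l, S l t ≤ 0 := by
      simp only [hS]
      rw [Finset.sum_comm]
      refine Finset.sum_nonpos fun k _ => ?_
      rw [← Finset.sum_div]
      refine div_nonpos_of_nonpos_of_nonneg ?_ (hζ k).le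
      simp only [← hzt]
      rw [Finset.sum_sub_distrib, ← Finset.mul_sum]
      simp only [hω]
      rw [hUU, hUU, Finset.mul_sum, ← Finset.sum_sub_distrib]
      refine Finset.sum_nonpos fun a _ => ?_
      have := hsec a k (z t a k)
      linarith
    have := Finset.add_sum_erase Finset.univ (fun l => S l t) (Finset.mem_univ 0)
    linarith
  have hVlim : Tendsto (fun t => ∑ l ∈ Finset.univ.erase 0, (X⁻¹ *ᵥ η l t) ⬝ᵥ η l t)
      atTop (nhds 0) := by
    refine aux_decay _ _ ε hε (fun t ht => HasDerivWithinAt.fun_sum fun l _ =>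
      aux_quad X⁻¹ hPsym (η l) _ _ t (hηd l t ht)) ?_ ?_
    · intro t ht
      have h1 := Finset.sum_le_sum fun l (hl : l ∈ Finset.univ.erase (0 : Fin N)) =>
        hineq l (Finset.ne_of_mem_erase hl) t
      rw [Finset.sum_add_distrib, ← Finset.mul_sum (Finset.univ.erase 0) (fun l => (X⁻¹ *ᵥ η l t) ⬝ᵥ η l t) ε] at h1
      have := hSsum t
      linarith
    · exact fun t => Finset.sum_nonneg fun l _ => hQ0 l t
  have hηlim : ∀ l, l ≠ 0 → ∀ p, Tendsto (fun t => η l t p) atTop (nhds 0) := by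
    intro l hl p
    have hsq : Tendsto (fun t => (η l t p) ^ 2) atTop (nhds 0) := by
      have hm := hVlim.const_mul (X p p)
      rw [mul_zero] at hm
      refine squeeze_zero (fun t => sq_nonneg _) (fun t => ?_) hm
      refine (aux_coord X hX (η l t) p).trans ?_
      refine mul_le_mul_of_nonneg_left ?_ hX.diag_pos.le
      exact Finset.single_le_sum (f := fun l => (X⁻¹ *ᵥ η l t) ⬝ᵥ η l t)
        (fun l _ => hQ0 l t) (Finset.mem_erase.2 ⟨hl, Finset.mem_univ _⟩)
    have := hsq.sqrt
    simp only [Real.sqrt_sq_eq_abs, Real.sqrt_zero] at this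
    exact (tendsto_zero_iff_abs_tendsto_zero _).2 this
  have hxη : ∀ t a p, x t (a, p) = ∑ l, U a l * η l t p := by
    intro t a p
    have : (U *ᵥ (Uᵀ *ᵥ fun b => x t (b, p))) a = x t (a, p) := by
      rw [Matrix.mulVec_mulVec, hU', Matrix.one_mulVec]
    rw [← this]
    rfl
  have hdiff : ∀ p, Tendsto (fun t => x t (i, p) - x t (j, p)) atTop (nhds 0) := by
    intro p
    have e : (fun t => x t (i, p) - x t (j, p)) = fun t => ∑ l, (U i l - U j l) * η l t p := by
      funext t
      rw [hxη, hxη, ← Finset.sum_sub_distrib]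
      exact Finset.sum_congr rfl fun l _ => by ring
    rw [e, show (0 : ℝ) = ∑ l : Fin N, 0 by simp]
    refine tendsto_finsetSum _ fun l _ => ?_
    by_cases hl : l = 0
    · subst hl
      simp [hcol i j]
    · simpa using (hηlim l hl p).const_mul (U i l - U j l)
  have hfin : Tendsto (fun t => ∑ p, (x t (i, p) - x t (j, p)) ^ 2) atTop (nhds 0) := by
    rw [show (0 : ℝ) = ∑ p : Fin n, 0 by simp]
    refine tendsto_finsetSum _ fun p _ => ?_
    simpa using (hdiff p).pow 2
  simpa using hfin.sqrt
end

section
/- Let L ∈ ℝ^{N×N}, K ∈ ℝ^{m×n}, P₂ ∈ ℝ^{n×n} symmetric positive definite, A ∈ ℝ^{n×n}, B ∈ ℝ^{n×m}, ε > 0, and Γ = diag(γ₁,…,γ_m) with all γ_k > 0. Set 𝒫 := P₁ ⊗ P₂, 𝒜 := I_N ⊗ A, ℬ := I_N ⊗ B. If the symmetric block matrix [[𝒫𝒜 + 𝒜ᵀ𝒫 + ε𝒫 − (LᵀL) ⊗ (KᵀΓΔ₁Δ₂K), 𝒫ℬ + (1/2)Lᵀ ⊗ (KᵀΓ(Δ₁+Δ₂))],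 [(𝒫ℬ + (1/2)Lᵀ ⊗ (KᵀΓ(Δ₁+Δ₂)))ᵀ, −I_N ⊗ Γ]] is negative semidefinite, then for every x ∈ ℝ^{Nn} and every u ∈ ℝ^{Nm} whose components satisfy (u_{i,k} − δ_{k,1}z_{i,k})(u_{i,k} − δ_{k,2}z_{i,k}) ≤ 0 for all i = 1,…,N, k = 1,…,m, where z := (L ⊗ K)x, one has xᵀ(𝒫𝒜 + 𝒜ᵀ𝒫 + ε𝒫)x + 2xᵀ𝒫ℬu ≤ 0. -/
open Matrix
open scoped Kronecker

/-- S-procedure step: with `calP := P₁ ⊗ P₂`, `calA := I_N ⊗ A`, `calB := I_N ⊗ B`,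
if the block matrix
`[[calPcalA + calAᵀcalP + εcalP − (LᵀL)⊗(KᵀΓΔ₁Δ₂K), calPcalB + (1/2)Lᵀ⊗(KᵀΓ(Δ₁+Δ₂))], [∙ᵀ, −I_N⊗Γ]]`
is negative semidefinite, then for all `x` and all `u` satisfying the sector conditions
w.r.t. `z := (L ⊗ K)x`, one has `xᵀ(calPcalA + calAᵀcalP + εcalP)x + 2xᵀcalPcalBu ≤ 0`. -/
theorem stmt2 (N n m : ℕ)
    (L : Matrix (Fin N) (Fin N) ℝ) (K : Matrix (Fin m) (Fin n) ℝ)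
    (P₂ : Matrix (Fin n) (Fin n) ℝ) (hP₂ : P₂.PosDef)
    (A : Matrix (Fin n) (Fin n) ℝ) (B : Matrix (Fin n) (Fin m) ℝ)
    (ε : ℝ) (hε : 0 < ε)
    (γ δ1 δ2 : Fin m → ℝ) (hγ : ∀ k, 0 < γ k) (hδ : ∀ k, δ1 k < δ2 k)
    (Γ Δ₁ Δ₂ : Matrix (Fin m) (Fin m) ℝ)
    (hΓ : Γ = Matrix.diagonal γ) (hΔ₁ : Δ₁ = Matrix.diagonal δ1)
    (hΔ₂ : Δ₂ = Matrix.diagonal δ2)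
    (P₁ : Matrix (Fin N) (Fin N) ℝ)
    (hP₁ : P₁ = (1 : Matrix (Fin N) (Fin N) ℝ)
      - (1 / (N : ℝ)) • Matrix.of (fun _ _ : Fin N => (1 : ℝ)))
    (calP : Matrix (Fin N × Fin n) (Fin N × Fin n) ℝ) (hcalP : calP = P₁ ⊗ₖ P₂)
    (calA : Matrix (Fin N × Fin n) (Fin N × Fin n) ℝ)
    (hcalA : calA = (1 : Matrix (Fin N) (Fin N) ℝ) ⊗ₖ A)
    (calB : Matrix (Fin N × Fin n) (Fin N × Fin m) ℝ)
    (hcalB : calB = (1 : Matrix (Fin N) (Fin N) ℝ) ⊗ₖ B)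
    (hLMI : NegSemidef (Matrix.fromBlocks
      (calP * calA + calAᵀ * calP + ε • calP - (Lᵀ * L) ⊗ₖ (Kᵀ * Γ * Δ₁ * Δ₂ * K))
      (calP * calB + (1 / 2 : ℝ) • (Lᵀ ⊗ₖ (Kᵀ * (Γ * (Δ₁ + Δ₂)))))
      (calP * calB + (1 / 2 : ℝ) • (Lᵀ ⊗ₖ (Kᵀ * (Γ * (Δ₁ + Δ₂)))))ᵀ
      (-((1 : Matrix (Fin N) (Fin N) ℝ) ⊗ₖ Γ)))) :
    ∀ (x : Fin N × Fin n → ℝ) (u : Fin N × Fin m → ℝ),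
      (∀ (i : Fin N) (k : Fin m),
        (u (i, k) - δ1 k * ((L ⊗ₖ K) *ᵥ x) (i, k))
          * (u (i, k) - δ2 k * ((L ⊗ₖ K) *ᵥ x) (i, k)) ≤ 0) →
      x ⬝ᵥ (calP * calA + calAᵀ * calP + ε • calP) *ᵥ x + 2 * (x ⬝ᵥ (calP * calB) *ᵥ u) ≤ 0 := by
  intro x u hs
  have h := hLMI (Sum.elim x u)
  set Q := calP * calA + calAᵀ * calP + ε • calP
  set R := calP * calB
  set Z := L ⊗ₖ K with hZ
  have h1 : (Lᵀ * L) ⊗ₖ (Kᵀ * Γ * Δ₁ * Δ₂ * K)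
      = Zᵀ * ((Matrix.diagonal fun p : Fin N × Fin m => γ p.2 * δ1 p.2 * δ2 p.2) * Z) := by
    have e : (Matrix.diagonal fun p : Fin N × Fin m => γ p.2 * δ1 p.2 * δ2 p.2)
        = (1 : Matrix (Fin N) (Fin N) ℝ) ⊗ₖ (Γ * Δ₁ * Δ₂) := by
      rw [hΓ, hΔ₁, hΔ₂, Matrix.diagonal_mul_diagonal, Matrix.diagonal_mul_diagonal,
        ← Matrix.diagonal_one, Matrix.diagonal_kronecker_diagonal]
      simp
    rw [e, hZ, ← Matrix.kroneckerMap_transpose, ← Matrix.mul_kronecker_mul,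
      ← Matrix.mul_kronecker_mul]
    simp only [Matrix.one_mul, Matrix.mul_assoc]
  have h2 : Lᵀ ⊗ₖ (Kᵀ * (Γ * (Δ₁ + Δ₂)))
      = Zᵀ * (Matrix.diagonal fun p : Fin N × Fin m => γ p.2 * (δ1 p.2 + δ2 p.2)) := by
    have e : (Matrix.diagonal fun p : Fin N × Fin m => γ p.2 * (δ1 p.2 + δ2 p.2))
        = (1 : Matrix (Fin N) (Fin N) ℝ) ⊗ₖ (Γ * (Δ₁ + Δ₂)) := by
      rw [hΓ, hΔ₁, hΔ₂, Matrix.diagonal_add, Matrix.diagonal_mul_diagonal,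
        ← Matrix.diagonal_one, Matrix.diagonal_kronecker_diagonal]
      simp
    rw [e, hZ, ← Matrix.kroneckerMap_transpose, ← Matrix.mul_kronecker_mul, Matrix.mul_one]
  have h3 : (1 : Matrix (Fin N) (Fin N) ℝ) ⊗ₖ Γ
      = Matrix.diagonal fun p : Fin N × Fin m => γ p.2 := by
    rw [hΓ, ← Matrix.diagonal_one, Matrix.diagonal_kronecker_diagonal]
    simp
  have hT : ∀ w : Fin N × Fin m → ℝ, x ⬝ᵥ Zᵀ *ᵥ w = (Z *ᵥ x) ⬝ᵥ w := by
    intro w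
    rw [Matrix.dotProduct_mulVec, Matrix.vecMul_transpose]
  have hT2 : ∀ M : Matrix (Fin N × Fin n) (Fin N × Fin m) ℝ,
      u ⬝ᵥ Mᵀ *ᵥ x = x ⬝ᵥ M *ᵥ u := by
    intro M
    rw [Matrix.dotProduct_mulVec, Matrix.vecMul_transpose, dotProduct_comm]
  rw [h1, h2, h3, Matrix.fromBlocks_mulVec] at h
  simp only [Sum.elim_comp_inl, Sum.elim_comp_inr, sumElim_dotProduct_sumElim,
    dotProduct_add, hT2] at h
  simp only [Matrix.sub_mulVec, Matrix.add_mulVec, Matrix.neg_mulVec, Matrix.smul_mulVec,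
    dotProduct_add, dotProduct_sub, dotProduct_neg, dotProduct_smul, ← Matrix.mulVec_mulVec,
    hT, smul_eq_mul] at h
  set z := Z *ᵥ x
  have key : z ⬝ᵥ ((Matrix.diagonal fun p : Fin N × Fin m => γ p.2 * δ1 p.2 * δ2 p.2) *ᵥ z)
      - z ⬝ᵥ ((Matrix.diagonal fun p : Fin N × Fin m => γ p.2 * (δ1 p.2 + δ2 p.2)) *ᵥ u)
      + u ⬝ᵥ ((Matrix.diagonal fun p : Fin N × Fin m => γ p.2) *ᵥ u) ≤ 0 := by
    simp only [dotProduct, Matrix.mulVec_diagonal]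
    rw [← Finset.sum_sub_distrib, ← Finset.sum_add_distrib]
    apply Finset.sum_nonpos
    rintro ⟨i, k⟩ -
    have := mul_nonpos_of_nonneg_of_nonpos (hγ k).le (hs i k)
    simp only
    nlinarith [this]
  have hQ : x ⬝ᵥ Q *ᵥ x = x ⬝ᵥ (calP * calA + calAᵀ * calP + ε • calP) *ᵥ x := rfl
  linarith
end

section
/- Let L ∈ ℝ^{N×N} be symmetric with L·𝟙_N = 0, and let U ∈ ℝ^{N×N} be an orthogonal matrix whose first column is 𝟙_N/√N and which diagonalizes L: UᵀLU = diag(0, λ₂, …, λ_N). Let A₀ ∈ ℝ^{n×n} be symmetric, B₀ ∈ ℝ^{n×n} arbitrary, and C₀ ∈ ℝ^{n×n} symmetric. Then the symmetric matrix P₁ ⊗ A₀ + (1/2)·sym(L ⊗ B₀) + (1/4)·(LᵀL) ⊗ C₀ ∈ ℝ^{Nn×Nn} is negative semidefinite if and only if for every i ∈ {2,…,N} the matrix A₀ + (1/2)λ_i·sym(B₀) + (1/4)λ_i²·C₀ is negative semidefinite. -/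
open Matrix
open scoped Kronecker

theorem ns_cong {d : Type*} [Fintype d] [DecidableEq d] (W D : Matrix d d ℝ) (hW : Wᵀ * W = 1) :
    NegSemidef (W * D * Wᵀ) ↔ NegSemidef D := by
  have key : ∀ v, v ⬝ᵥ (W * D * Wᵀ) *ᵥ v = (Wᵀ *ᵥ v) ⬝ᵥ D *ᵥ (Wᵀ *ᵥ v) := by
    intro v
    rw [← Matrix.mulVec_mulVec, ← Matrix.mulVec_mulVec, Matrix.dotProduct_mulVec,
      ← Matrix.mulVec_transpose]
  constructor
  · intro h v
    have := h (W *ᵥ v)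
    rw [key, Matrix.mulVec_mulVec, hW, Matrix.one_mulVec] at this
    exact this
  · intro h v
    rw [key]
    exact h _

theorem kron_conj {N n : ℕ} (U D : Matrix (Fin N) (Fin N) ℝ) (A : Matrix (Fin n) (Fin n) ℝ) :
    (U * D * Uᵀ) ⊗ₖ A = (U ⊗ₖ (1 : Matrix (Fin n) (Fin n) ℝ)) * (D ⊗ₖ A) *
      (U ⊗ₖ (1 : Matrix (Fin n) (Fin n) ℝ))ᵀ := by
  rw [← Matrix.kroneckerMap_transpose, Matrix.transpose_one, ← Matrix.mul_kronecker_mul,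
    ← Matrix.mul_kronecker_mul, Matrix.one_mul, Matrix.mul_one]

theorem ns_block {N n : ℕ} (D : Matrix (Fin N × Fin n) (Fin N × Fin n) ℝ)
    (K : Fin N → Matrix (Fin n) (Fin n) ℝ)
    (hD : ∀ i a j b, D (i, a) (j, b) = if i = j then K i a b else 0) :
    NegSemidef D ↔ ∀ i, NegSemidef (K i) := by
  have key : ∀ v : Fin N × Fin n → ℝ,
      v ⬝ᵥ D *ᵥ v = ∑ i, (fun a => v (i, a)) ⬝ᵥ K i *ᵥ (fun a => v (i, a)) := by
    intro v
    simp only [dotProduct, Matrix.mulVec, Fintype.sum_prod_type, hD]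
    refine Finset.sum_congr rfl fun i _ => Finset.sum_congr rfl fun a _ => ?_
    congr 1
    rw [Finset.sum_eq_single i]
    · simp
    · intro j _ hj
      simp [hj.symm]
    · simp
  constructor
  · intro h i w
    have := h (fun p => if p.1 = i then w p.2 else 0)
    rw [key, Finset.sum_eq_single i] at this
    · simpa using this
    · intro j _ hj
      simp [hj, dotProduct]
    · simp
  · intro h v
    rw [key]
    exact Finset.sum_nonpos fun i _ => h i _

/-- for symmetric `L` with `L𝟙 = 0` diagonalized by an orthogonal `U` whose
first column is `𝟙/√N`, `UᵀLU = diag(0, λ₂, …, λ_N)`, the matrix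
`P₁ ⊗ A₀ + (1/2)·sym(L ⊗ B₀) + (1/4)·(LᵀL) ⊗ C₀` is negative semidefinite iff
`A₀ + (1/2)λᵢ·sym(B₀) + (1/4)λᵢ²·C₀` is negative semidefinite for every `i ∈ {2,…,N}`. -/
theorem stmt7 (N n : ℕ) [NeZero N]
    (L : Matrix (Fin N) (Fin N) ℝ) (hLsym : L.IsSymm)
    (hLone : L *ᵥ (fun _ => (1 : ℝ)) = 0)
    (U : Matrix (Fin N) (Fin N) ℝ) (hU : Uᵀ * U = 1)
    (hUcol : ∀ i : Fin N, U i 0 = 1 / Real.sqrt N)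
    (lam : Fin N → ℝ) (hlam0 : lam 0 = 0)
    (hdiag : Uᵀ * L * U = Matrix.diagonal lam)
    (A₀ : Matrix (Fin n) (Fin n) ℝ) (hA₀ : A₀.IsSymm)
    (B₀ : Matrix (Fin n) (Fin n) ℝ)
    (C₀ : Matrix (Fin n) (Fin n) ℝ) (hC₀ : C₀.IsSymm)
    (P₁ : Matrix (Fin N) (Fin N) ℝ)
    (hP₁ : P₁ = (1 : Matrix (Fin N) (Fin N) ℝ)
      - (1 / (N : ℝ)) • Matrix.of (fun _ _ : Fin N => (1 : ℝ))) :
    NegSemidef (P₁ ⊗ₖ A₀ + (1 / 2 : ℝ) • symMat (L ⊗ₖ B₀)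
        + (1 / 4 : ℝ) • ((Lᵀ * L) ⊗ₖ C₀))
      ↔ ∀ i : Fin N, i ≠ 0 →
          NegSemidef (A₀ + ((1 / 2) * lam i) • symMat B₀ + ((1 / 4) * (lam i) ^ 2) • C₀) := by
  have hU' : U * Uᵀ = 1 := mul_eq_one_comm.mp hU
  have hL : L = U * Matrix.diagonal lam * Uᵀ := by
    rw [← hdiag]
    calc L = (U * Uᵀ) * L * (U * Uᵀ) := by rw [hU']; simp
      _ = _ := by simp only [Matrix.mul_assoc]
  have hLL : Lᵀ * L = U * Matrix.diagonal (fun i => lam i ^ 2) * Uᵀ := by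
    rw [hLsym.eq]
    calc L * L = U * Matrix.diagonal lam * (Uᵀ * U) * Matrix.diagonal lam * Uᵀ := by
          rw [hL]; simp only [Matrix.mul_assoc]
      _ = U * (Matrix.diagonal lam * Matrix.diagonal lam) * Uᵀ := by
          rw [hU]; simp only [Matrix.mul_assoc, Matrix.one_mul]
      _ = _ := by rw [Matrix.diagonal_mul_diagonal]; simp only [pow_two]
  have hP : P₁ = U * Matrix.diagonal (fun i => if i = 0 then (0 : ℝ) else 1) * Uᵀ := by
    have h1 : Matrix.diagonal (fun i : Fin N => if i = 0 then (0 : ℝ) else 1)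
        = 1 - Matrix.diagonal (fun i : Fin N => if i = 0 then (1 : ℝ) else 0) := by
      rw [← Matrix.diagonal_one, Matrix.diagonal_sub]
      congr 1
      ext i
      split_ifs <;> simp
    rw [h1, Matrix.mul_sub, Matrix.sub_mul, Matrix.mul_one, hU', hP₁]
    congr 1
    ext i j
    rw [Matrix.mul_apply]
    simp only [Matrix.mul_diagonal, Matrix.transpose_apply, mul_ite, mul_one, mul_zero,
      ite_mul, zero_mul, Finset.sum_ite_eq', Finset.mem_univ, if_true, hUcol, Matrix.smul_apply,
      Matrix.of_apply, smul_eq_mul, Finset.sum_ite_eq]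
    rw [div_mul_div_comm, Real.mul_self_sqrt (Nat.cast_nonneg N), one_mul]
  have hT : (L ⊗ₖ B₀)ᵀ = L ⊗ₖ B₀ᵀ := by
    rw [← Matrix.kroneckerMap_transpose, hLsym.eq]
  have hW : (U ⊗ₖ (1 : Matrix (Fin n) (Fin n) ℝ))ᵀ * (U ⊗ₖ (1 : Matrix (Fin n) (Fin n) ℝ)) = 1 := by
    rw [← Matrix.kroneckerMap_transpose, ← Matrix.mul_kronecker_mul, hU, Matrix.transpose_one,
      Matrix.one_mul, Matrix.one_kronecker_one]
  have hM : P₁ ⊗ₖ A₀ + (1 / 2 : ℝ) • symMat (L ⊗ₖ B₀) + (1 / 4 : ℝ) • ((Lᵀ * L) ⊗ₖ C₀)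
      = (U ⊗ₖ (1 : Matrix (Fin n) (Fin n) ℝ)) *
        (Matrix.diagonal (fun i => if i = 0 then (0 : ℝ) else 1) ⊗ₖ A₀
          + (1 / 2 : ℝ) • (Matrix.diagonal lam ⊗ₖ B₀ + Matrix.diagonal lam ⊗ₖ B₀ᵀ)
          + (1 / 4 : ℝ) • (Matrix.diagonal (fun i => lam i ^ 2) ⊗ₖ C₀)) *
        (U ⊗ₖ (1 : Matrix (Fin n) (Fin n) ℝ))ᵀ := by
    rw [symMat, hT, hLL, hP]
    rw [hL]
    simp only [kron_conj, Matrix.mul_add, Matrix.add_mul, Matrix.mul_smul, Matrix.smul_mul]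
  rw [hM, ns_cong _ _ hW, ns_block _ (fun i => if i = 0 then 0 else
    A₀ + ((1 / 2) * lam i) • symMat B₀ + ((1 / 4) * (lam i) ^ 2) • C₀)]
  · refine forall_congr' fun i => ?_
    by_cases hi : i = 0
    · simp [hi, NegSemidef]
    · simp [hi]
  · intro i a j b
    by_cases hij : i = j
    · subst hij
      by_cases hi : i = 0
      · subst hi
        simp [hlam0]
      · simp [hi, symMat]
        ring
    · simp [hij]
end

section
/- Let P₂ ∈ ℝ^{n×n} be symmetric positive definite and let μ > 0 be its smallest eigenvalue. Set P₁ := I_N − (1/N)𝟙_N𝟙_Nᵀ. Then for every x ∈ ℝ^{Nn} with blocks x₁,…,x_N ∈ ℝⁿ and every pair of indices i ≠ j, ‖x_i − x_j‖² ≤ (2/μ)·xᵀ(P₁ ⊗ P₂)x, where ‖·‖ is the Euclidean norm on ℝⁿ. In particular, if x(t) is any curve in ℝ^{Nn} along which x(t)ᵀ(P₁ ⊗ P₂)x(t) → 0 as t → ∞, then ‖x_i(t) − x_j(t)‖ → 0 for all i, j. -/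
open Matrix Filter
open scoped Kronecker

theorem rayleigh_aux (n : ℕ) (A : Matrix (Fin n) (Fin n) ℝ) (hA : A.PosDef) (μ : ℝ)
    (hmin : ∀ ν : ℝ, (∃ v : Fin n → ℝ, v ≠ 0 ∧ A *ᵥ v = ν • v) → μ ≤ ν)
    (v : Fin n → ℝ) : μ * ∑ p, v p ^ 2 ≤ v ⬝ᵥ A *ᵥ v := by
  have hB : (A - μ • (1 : Matrix (Fin n) (Fin n) ℝ)).IsHermitian := by
    apply hA.isHermitian.sub
    simp [Matrix.IsHermitian]
  have hps : (A - μ • (1 : Matrix (Fin n) (Fin n) ℝ)).PosSemidef := by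
    rw [hB.posSemidef_iff_eigenvalues_nonneg]
    intro k
    have h1 := hB.mulVec_eigenvectorBasis k
    have h2 : (hB.eigenvectorBasis k).ofLp ≠ 0 := by
      intro h
      exact hB.eigenvectorBasis.orthonormal.ne_zero k (by ext q; simpa using congrFun h q)
    have h3 := hmin (hB.eigenvalues k + μ) ⟨_, h2, by
      rw [add_smul, ← h1, Matrix.sub_mulVec, Matrix.smul_mulVec, Matrix.one_mulVec]
      simp⟩
    simp only [Pi.zero_apply]
    linarith
  have h := hps.dotProduct_mulVec_nonneg v
  rw [Matrix.sub_mulVec, Matrix.smul_mulVec, Matrix.one_mulVec] at h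
  simp only [star_trivial, dotProduct_sub, dotProduct_smul, smul_eq_mul] at h
  have h4 : v ⬝ᵥ v = ∑ p, v p ^ 2 := by simp [dotProduct, sq]
  rw [h4] at h
  linarith

theorem center_aux (N : ℕ) (hN : (N : ℝ) ≠ 0) (a b : Fin N → ℝ) :
    ∑ k, ∑ l, ((1 : Matrix (Fin N) (Fin N) ℝ)
      - (1 / (N : ℝ)) • Matrix.of (fun _ _ : Fin N => (1 : ℝ))) k l * (a k * b l) =
    ∑ k, (a k - (∑ l, a l) / N) * (b k - (∑ l, b l) / N) := by
  have h1 : ∑ k, (a k - (∑ l, a l) / N) * (b k - (∑ l, b l) / N)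
      = ∑ k, a k * b k - (∑ l, a l) * (∑ l, b l) / N := by
    simp only [sub_mul, mul_sub, Finset.sum_sub_distrib, ← Finset.sum_mul, ← Finset.mul_sum]
    simp
    field_simp
    ring
  rw [h1]
  simp only [Matrix.sub_apply, Matrix.smul_apply, Matrix.of_apply, Matrix.one_apply, sub_mul,
    Finset.sum_sub_distrib, ite_mul, one_mul, zero_mul, Finset.sum_ite_eq, Finset.mem_univ, if_true,
    smul_eq_mul, mul_one]
  simp only [← Finset.mul_sum, ← Finset.sum_mul]
  ring

theorem quad_aux (N n : ℕ) (hN : (N : ℝ) ≠ 0) (A : Matrix (Fin n) (Fin n) ℝ)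
    (x : Fin N × Fin n → ℝ) :
    x ⬝ᵥ (((1 : Matrix (Fin N) (Fin N) ℝ)
      - (1 / (N : ℝ)) • Matrix.of (fun _ _ : Fin N => (1 : ℝ))) ⊗ₖ A) *ᵥ x =
    ∑ k, (fun p => x (k, p) - (∑ l, x (l, p)) / N) ⬝ᵥ
      A *ᵥ (fun p => x (k, p) - (∑ l, x (l, p)) / N) := by
  have hc := fun p q => center_aux N hN (fun k => x (k, p)) (fun k => x (k, q))
  generalize ((1 : Matrix (Fin N) (Fin N) ℝ)
      - (1 / (N : ℝ)) • Matrix.of (fun _ _ : Fin N => (1 : ℝ))) = P at *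
  trans ∑ p, ∑ q, A p q * ∑ k, ∑ l, P k l * (x (k, p) * x (l, q))
  · simp only [dotProduct, Matrix.mulVec, Fintype.sum_prod_type, Matrix.kroneckerMap_apply,
      Finset.mul_sum]
    rw [Finset.sum_comm]
    refine Finset.sum_congr rfl fun p _ => ?_
    conv_rhs => rw [Finset.sum_comm]
    refine Finset.sum_congr rfl fun k _ => ?_
    conv_lhs => rw [Finset.sum_comm]
    refine Finset.sum_congr rfl fun q _ => ?_
    refine Finset.sum_congr rfl fun l _ => ?_
    ring
  · simp only [hc]
    simp only [dotProduct, Matrix.mulVec, Finset.mul_sum]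
    conv_rhs => rw [Finset.sum_comm]
    refine Finset.sum_congr rfl fun p _ => ?_
    conv_rhs => rw [Finset.sum_comm]
    refine Finset.sum_congr rfl fun q _ => ?_
    refine Finset.sum_congr rfl fun k _ => ?_
    ring

/-- with `P₂` symmetric positive definite with smallest eigenvalue `μ > 0`
and `P₁ := I_N − (1/N)𝟙𝟙ᵀ`, one has `‖x_i − x_j‖² ≤ (2/μ)·xᵀ(P₁ ⊗ P₂)x`; in particular
if `x(t)ᵀ(P₁ ⊗ P₂)x(t) → 0` then `‖x_i(t) − x_j(t)‖ → 0` for all `i, j`. -/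
theorem stmt13 (N n : ℕ)
    (P₂ : Matrix (Fin n) (Fin n) ℝ) (hP₂ : P₂.PosDef)
    (μ : ℝ) (hμpos : 0 < μ)
    (hμeig : ∃ v : Fin n → ℝ, v ≠ 0 ∧ P₂ *ᵥ v = μ • v)
    (hμmin : ∀ ν : ℝ, (∃ v : Fin n → ℝ, v ≠ 0 ∧ P₂ *ᵥ v = ν • v) → μ ≤ ν)
    (P₁ : Matrix (Fin N) (Fin N) ℝ)
    (hP₁ : P₁ = (1 : Matrix (Fin N) (Fin N) ℝ)
      - (1 / (N : ℝ)) • Matrix.of (fun _ _ : Fin N => (1 : ℝ))) :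
    (∀ x : Fin N × Fin n → ℝ, ∀ i j : Fin N, i ≠ j →
      (∑ p, (x (i, p) - x (j, p)) ^ 2) ≤ (2 / μ) * (x ⬝ᵥ (P₁ ⊗ₖ P₂) *ᵥ x)) ∧
    ∀ x : ℝ → (Fin N × Fin n → ℝ),
      Tendsto (fun t => x t ⬝ᵥ (P₁ ⊗ₖ P₂) *ᵥ x t) atTop (nhds 0) →
      ∀ i j : Fin N,
        Tendsto (fun t => Real.sqrt (∑ p, (x t (i, p) - x t (j, p)) ^ 2)) atTop (nhds 0) := by
  have main : ∀ x : Fin N × Fin n → ℝ, ∀ i j : Fin N, i ≠ j →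
      (∑ p, (x (i, p) - x (j, p)) ^ 2) ≤ (2 / μ) * (x ⬝ᵥ (P₁ ⊗ₖ P₂) *ᵥ x) := by
    intro x i j hij
    have hN : (N : ℝ) ≠ 0 := by
      have := i.pos
      positivity
    rw [hP₁, quad_aux N n hN]
    set y : Fin N → Fin n → ℝ := fun k p => x (k, p) - (∑ l, x (l, p)) / N with hy
    have h1 : ∀ k, μ * ∑ p, y k p ^ 2 ≤ y k ⬝ᵥ P₂ *ᵥ y k :=
      fun k => rayleigh_aux n P₂ hP₂ μ hμmin (y k)
    have h0 : ∀ k, 0 ≤ y k ⬝ᵥ P₂ *ᵥ y k := fun k =>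
      le_trans (mul_nonneg hμpos.le (Finset.sum_nonneg fun p _ => sq_nonneg _)) (h1 k)
    have h2 : y i ⬝ᵥ P₂ *ᵥ y i + y j ⬝ᵥ P₂ *ᵥ y j ≤ ∑ k, y k ⬝ᵥ P₂ *ᵥ y k := by
      rw [← Finset.sum_pair (f := fun k => y k ⬝ᵥ P₂ *ᵥ y k) hij]
      exact Finset.sum_le_sum_of_subset_of_nonneg (Finset.subset_univ _) fun k _ _ => h0 k
    have h3 : ∑ p, (x (i, p) - x (j, p)) ^ 2 ≤ 2 * (∑ p, y i p ^ 2 + ∑ p, y j p ^ 2) := by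
      rw [← Finset.sum_add_distrib, Finset.mul_sum]
      refine Finset.sum_le_sum fun p _ => ?_
      have : x (i, p) - x (j, p) = y i p - y j p := by simp [hy]
      rw [this]
      nlinarith [sq_nonneg (y i p + y j p)]
    rw [div_mul_eq_mul_div, le_div_iff₀ hμpos]
    have := mul_le_mul_of_nonneg_right h3 hμpos.le
    change _ ≤ 2 * ∑ k, y k ⬝ᵥ P₂ *ᵥ y k
    linarith [h1 i, h1 j]
  refine ⟨main, fun x hx i j => ?_⟩
  by_cases hij : i = j
  · subst hij
    simp
  have h := (hx.const_mul (2 / μ)).sqrt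
  simp only [mul_zero, Real.sqrt_zero] at h
  exact squeeze_zero (fun t => Real.sqrt_nonneg _)
    (fun t => Real.sqrt_le_sqrt (main (x t) i j hij)) h
end
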